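/- arXiv:1309.2543 — 5 statements merged into one kernel-verified Lean document; each statement's English description precedes it below -/
import Mathlib

section
/- For every integer k ≥ 1 and real numbers a_0, a_1, …, a_k with a_0 = 1 and a_i > 0 for all i = 1, …, k, one has (ln(∑_{i=0}^{k} e^{a_i}))² ≤ (ln(k+1))² + (1 + 2 ln(k+1)) · ∑_{i=0}^{k} a_i². -/
/-- Lemma 3 (technical inequality): for `k ≥ 1` and reals `a₀ = 1`, `aᵢ > 0`,
`(ln ∑ᵢ e^{aᵢ})² ≤ ln²(k+1) + (1 + 2 ln(k+1)) ∑ᵢ aᵢ²`. -/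
theorem stmt0 (k : ℕ) (hk : 1 ≤ k) (a : Fin (k + 1) → ℝ)
    (ha0 : a 0 = 1) (hpos : ∀ i : Fin (k + 1), i ≠ 0 → 0 < a i) :
    (Real.log (∑ i, Real.exp (a i))) ^ 2 ≤
      (Real.log (k + 1)) ^ 2 + (1 + 2 * Real.log (k + 1)) * ∑ i, (a i) ^ 2 := by
  set S := ∑ i, (a i) ^ 2
  have hle (i : Fin (k + 1)) : (a i) ^ 2 ≤ S :=
    Finset.single_le_sum (f := fun i => (a i) ^ 2) (fun j _ => sq_nonneg _) (Finset.mem_univ i)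
  have hS1 : 1 ≤ S := by simpa [ha0] using hle 0
  have hM1 : 1 ≤ √S := Real.one_le_sqrt.mpr hS1
  have hMsq : √S ^ 2 = S := Real.sq_sqrt (by linarith)
  have hk0 : (0 : ℝ) < k + 1 := by positivity
  have hlog : 0 ≤ Real.log (k + 1) := Real.log_nonneg (by simp)
  have hsum : ∑ i, Real.exp (a i) ≤ (k + 1) * Real.exp √S := by
    calc ∑ i, Real.exp (a i) ≤ ∑ _i : Fin (k + 1), Real.exp √S :=
          Finset.sum_le_sum fun i _ => Real.exp_le_exp.mpr (Real.le_sqrt_of_sq_le (hle i))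
      _ = (k + 1) * Real.exp √S := by simp
  have hone : 1 ≤ ∑ i, Real.exp (a i) :=
    (Real.one_le_exp (by simp [ha0])).trans
      (Finset.single_le_sum (f := fun i => Real.exp (a i)) (fun j _ => (Real.exp_pos _).le)
        (Finset.mem_univ 0))
  have hL : Real.log (∑ i, Real.exp (a i)) ≤ Real.log (k + 1) + √S := by
    have h := Real.log_le_log (by linarith) hsum
    rwa [Real.log_mul hk0.ne' (Real.exp_pos _).ne', Real.log_exp] at h
  calc (Real.log (∑ i, Real.exp (a i))) ^ 2 ≤ (Real.log (k + 1) + √S) ^ 2 :=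
        pow_le_pow_left₀ (Real.log_nonneg hone) hL 2
    _ = Real.log (k + 1) ^ 2 + 2 * Real.log (k + 1) * √S + S := by rw [add_sq, hMsq]
    _ ≤ Real.log (k + 1) ^ 2 + (1 + 2 * Real.log (k + 1)) * S := by
        have h : √S ≤ S := by nlinarith
        nlinarith [mul_le_mul_of_nonneg_left h hlog]
end

section
/- The function V : ℝ → ℝ defined by V(γ) = ln(ln(1 + e^γ)) is concave on ℝ. -/
theorem log_one_add_exp_pos (x : ℝ) : 0 < Real.log (1 + Real.exp x) :=
  Real.log_pos (by linarith [Real.exp_pos x])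

theorem hasDerivAt_log_one_add_exp (x : ℝ) :
    HasDerivAt (fun y : ℝ => Real.log (1 + Real.exp y)) (Real.exp x / (1 + Real.exp x)) x :=
  ((Real.hasDerivAt_exp x).const_add 1).log (by positivity)

theorem hasDerivAt_log_log_one_add_exp (x : ℝ) :
    HasDerivAt (fun y : ℝ => Real.log (Real.log (1 + Real.exp y)))
      (Real.exp x / ((1 + Real.exp x) * Real.log (1 + Real.exp x))) x := by
  simpa only [div_div] using (hasDerivAt_log_one_add_exp x).log (log_one_add_exp_pos x).ne'

theorem antitone_exp_div_one_add_exp_mul_log :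
    Antitone fun x : ℝ => Real.exp x / ((1 + Real.exp x) * Real.log (1 + Real.exp x)) := by
  have hd (x : ℝ) := (Real.hasDerivAt_exp x).fun_div
    (((Real.hasDerivAt_exp x).const_add 1).fun_mul (hasDerivAt_log_one_add_exp x))
    (mul_pos (by positivity) (log_one_add_exp_pos x)).ne'
  refine antitone_of_deriv_nonpos (fun x => (hd x).differentiableAt) fun x => ?_
  rw [(hd x).deriv]
  refine div_nonpos_of_nonpos_of_nonneg ?_ (sq_nonneg _)
  have he : 0 < Real.exp x := Real.exp_pos x
  have hlog : Real.log (1 + Real.exp x) ≤ Real.exp x := by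
    linarith [Real.log_le_sub_one_of_pos (show 0 < 1 + Real.exp x by positivity)]
  rw [mul_div_cancel₀ _ (by positivity : 1 + Real.exp x ≠ 0)]
  nlinarith [mul_nonneg he.le (sub_nonneg.2 hlog)]

/-- The per-UE utility `V(γ) = ln ln(1 + e^γ)` is concave on `ℝ`. -/
theorem stmt3 :
    ConcaveOn ℝ Set.univ (fun γ : ℝ => Real.log (Real.log (1 + Real.exp γ))) := by
  refine Antitone.concaveOn_univ_of_deriv
    (fun x => (hasDerivAt_log_log_one_add_exp x).differentiableAt) ?_
  rw [funext fun x => (hasDerivAt_log_log_one_add_exp x).deriv]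
  exact antitone_exp_div_one_add_exp_mul_log
end

section
/- Let E be a finite index set and, for each e ∈ E, let a_e ≥ 0 and m_{e,1}, m_{e,2}, c_{e,11}, c_{e,12}, c_{e,22} be real numbers with c_{e,11} ≥ 0, and let N₀ > 0. Then the function F : ℝ^E × ℝ^E → ℝ defined by F(π, α) = ln( ∑_{e ∈ E} a_e · exp(π_e + α_e·m_{e,1} − m_{e,2} + (1/2)·(c_{e,11}·α_e² − 2·c_{e,12}·α_e + c_{e,22})) + N₀ ) is convex on ℝ^E × ℝ^E. -/
/-- The logarithm of a positive constant plus a nonnegative combination of exponentials of convex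
functions is convex. -/
theorem ConvexOn.log_sum_mul_exp_add_const {V ι : Type*} [AddCommGroup V] [Module ℝ V] [Fintype ι]
    {s : Set V} (hs : Convex ℝ s) {f : ι → V → ℝ} (hf : ∀ i, ConvexOn ℝ s (f i))
    {a : ι → ℝ} (ha : ∀ i, 0 ≤ a i) {c : ℝ} (hc : 0 < c) :
    ConvexOn ℝ s (fun x => Real.log (∑ i, a i * Real.exp (f i x) + c)) := by
  have hpos : ∀ x, 0 < ∑ i, a i * Real.exp (f i x) + c := fun x =>
    add_pos_of_nonneg_of_pos
      (Finset.sum_nonneg fun i _ => mul_nonneg (ha i) (Real.exp_pos _).le) hc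
  refine ⟨hs, fun x hx y hy p q hp hq hpq => ?_⟩
  simp only [smul_eq_mul]
  set L : V → ℝ := fun x => Real.log (∑ i, a i * Real.exp (f i x) + c)
  have hnorm : ∀ x, ∑ i, a i * Real.exp (f i x - L x) + c * Real.exp (-L x) = 1 := by
    intro x
    have hexp : Real.exp (L x) = ∑ i, a i * Real.exp (f i x) + c := Real.exp_log (hpos x)
    calc ∑ i, a i * Real.exp (f i x - L x) + c * Real.exp (-L x)
        = (∑ i, a i * Real.exp (f i x) + c) * Real.exp (-L x) := by
          simp only [sub_eq_add_neg, Real.exp_add, add_mul, Finset.sum_mul, mul_assoc]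
      _ = 1 := by rw [← hexp, ← Real.exp_add, add_neg_cancel, Real.exp_zero]
  have hconv : ∀ u v : ℝ, Real.exp (p * u + q * v) ≤ p * Real.exp u + q * Real.exp v :=
    fun u v => convexOn_exp.2 (Set.mem_univ u) (Set.mem_univ v) hp hq hpq
  set M := p * L x + q * L y with hM
  have hterm : ∀ i, a i * Real.exp (f i (p • x + q • y) - M) ≤
      p * (a i * Real.exp (f i x - L x)) + q * (a i * Real.exp (f i y - L y)) := by
    intro i
    have hfi : f i (p • x + q • y) ≤ p * f i x + q * f i y := (hf i).2 hx hy hp hq hpq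
    calc a i * Real.exp (f i (p • x + q • y) - M)
        ≤ a i * Real.exp (p * (f i x - L x) + q * (f i y - L y)) :=
          mul_le_mul_of_nonneg_left (Real.exp_le_exp.2 (by linarith)) (ha i)
      _ ≤ a i * (p * Real.exp (f i x - L x) + q * Real.exp (f i y - L y)) :=
          mul_le_mul_of_nonneg_left (hconv _ _) (ha i)
      _ = _ := by ring
  have hconst : c * Real.exp (-M) ≤ p * (c * Real.exp (-L x)) + q * (c * Real.exp (-L y)) := by
    have hM' : -M = p * (-L x) + q * (-L y) := by rw [hM]; ring
    rw [hM']
    exact (mul_le_mul_of_nonneg_left (hconv _ _) hc.le).trans_eq (by ring)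
  have hle : (∑ i, a i * Real.exp (f i (p • x + q • y)) + c) * Real.exp (-M) ≤ 1 := by
    calc (∑ i, a i * Real.exp (f i (p • x + q • y)) + c) * Real.exp (-M)
        = ∑ i, a i * Real.exp (f i (p • x + q • y) - M) + c * Real.exp (-M) := by
          simp only [sub_eq_add_neg, Real.exp_add, add_mul, Finset.sum_mul, mul_assoc]
      _ ≤ ∑ i, (p * (a i * Real.exp (f i x - L x)) + q * (a i * Real.exp (f i y - L y))) +
          (p * (c * Real.exp (-L x)) + q * (c * Real.exp (-L y))) :=
          add_le_add (Finset.sum_le_sum fun i _ => hterm i) hconst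
      _ = p * (∑ i, a i * Real.exp (f i x - L x) + c * Real.exp (-L x)) +
          q * (∑ i, a i * Real.exp (f i y - L y) + c * Real.exp (-L y)) := by
          rw [Finset.sum_add_distrib, ← Finset.mul_sum, ← Finset.mul_sum]; ring
      _ = 1 := by rw [hnorm, hnorm, mul_one, mul_one, hpq]
  rw [Real.log_le_iff_le_exp (hpos _)]
  rwa [Real.exp_neg, ← div_eq_mul_inv, div_le_one (Real.exp_pos _)] at hle


/-- Lemma 2: the interference constraint function of IoTC-CE,
`F(π, α) = ln(∑ₑ aₑ exp(πₑ + αₑ mₑ₁ − mₑ₂ + ½(cₑ₁₁ αₑ² − 2 cₑ₁₂ αₑ + cₑ₂₂)) + N₀)`,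
is convex on `ℝ^E × ℝ^E` whenever `aₑ ≥ 0`, `cₑ₁₁ ≥ 0` and `N₀ > 0`. -/
theorem stmt6 (E : Type) [Fintype E] (a m₁ m₂ c₁₁ c₁₂ c₂₂ : E → ℝ)
    (ha : ∀ e, 0 ≤ a e) (hc₁₁ : ∀ e, 0 ≤ c₁₁ e) (N₀ : ℝ) (hN₀ : 0 < N₀) :
    ConvexOn ℝ Set.univ (fun z : (E → ℝ) × (E → ℝ) =>
      Real.log (∑ e, a e * Real.exp (z.1 e + z.2 e * m₁ e - m₂ e +
        (1 / 2) * (c₁₁ e * (z.2 e) ^ 2 - 2 * c₁₂ e * z.2 e + c₂₂ e)) + N₀)) := by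
  refine ConvexOn.log_sum_mul_exp_add_const convex_univ
    (fun e => ⟨convex_univ, fun x _ y _ p q hp hq hpq => ?_⟩) ha hN₀
  obtain rfl : q = 1 - p := by linarith
  simp only [Prod.fst_add, Prod.snd_add, Prod.smul_fst, Prod.smul_snd, Pi.add_apply, Pi.smul_apply,
    smul_eq_mul]
  have hgap : 0 ≤ p * (1 - p) * (c₁₁ e * (x.2 e - y.2 e) ^ 2) :=
    mul_nonneg (mul_nonneg hp hq) (mul_nonneg (hc₁₁ e) (sq_nonneg _))
  linear_combination (1 / 2) * hgap
end

section
/- Let (Ω, 𝔽, μ) be a probability space, N₀ > 0 a real number, and S : Ω → ℝ a nonnegative measurable function that is μ-integrable and such that ω ↦ (ln(S(ω) + N₀))² is μ-integrable. Then ∫_Ω (ln(S(ω) + N₀))² dμ(ω) ≤ ( ln( ∫_Ω S dμ + e + N₀ ) )² + (ln N₀)². -/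
open MeasureTheory

theorem concaveOn_log_sq :
    ConcaveOn ℝ (Set.Ici (Real.exp 1)) (fun x : ℝ => (Real.log x) ^ 2) := by
  have hpos : ∀ x ∈ Set.Ici (Real.exp 1), x ≠ 0 := fun x hx =>
    ((Real.exp_pos 1).trans_le hx).ne'
  have hderiv : ∀ x ∈ Set.Ici (Real.exp 1),
      HasDerivAt (fun x : ℝ => (Real.log x) ^ 2) (2 * (Real.log x / x)) x := fun x hx => by
    refine ((Real.hasDerivAt_log (hpos x hx)).fun_pow 2).congr_deriv ?_
    rw [div_eq_mul_inv]
    ring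
  refine AntitoneOn.concaveOn_of_deriv (convex_Ici _)
    (fun x hx => (hderiv x hx).continuousAt.continuousWithinAt)
    (fun x hx => (hderiv x (interior_subset hx)).differentiableAt.differentiableWithinAt) ?_
  intro x hx y hy hxy
  have hx' := interior_subset hx
  have hy' := interior_subset hy
  rw [(hderiv x hx').deriv, (hderiv y hy').deriv]
  exact mul_le_mul_of_nonneg_left (Real.log_div_self_antitoneOn hx' hy' hxy) zero_le_two

theorem log_sq_le_two_mul {x : ℝ} (hx : 1 ≤ x) : (Real.log x) ^ 2 ≤ 2 * x := by
  have h := Real.quadratic_le_exp_of_nonneg (Real.log_nonneg hx)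
  rw [Real.exp_log (zero_lt_one.trans_le hx)] at h
  linarith [Real.log_nonneg hx]

theorem log_add_sq_le {x y : ℝ} (hx : 0 ≤ x) (hy : 0 < y) :
    (Real.log (x + y)) ^ 2 ≤ (Real.log (x + Real.exp 1 + y)) ^ 2 + (Real.log y) ^ 2 := by
  have he := Real.exp_pos 1
  rcases le_total 1 (x + y) with h | h
  · have h0 := Real.log_nonneg h
    have h1 : Real.log (x + y) ≤ Real.log (x + Real.exp 1 + y) :=
      Real.log_le_log (by linarith) (by linarith)
    nlinarith [sq_nonneg (Real.log y)]
  · have h0 := Real.log_nonpos (by linarith) h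
    have h1 : Real.log y ≤ Real.log (x + y) := Real.log_le_log hy (by linarith)
    nlinarith [sq_nonneg (Real.log (x + Real.exp 1 + y))]

/-- Intermediate second-moment bound: for a nonnegative integrable random
interference `S` and noise power `N₀ > 0`,
`E[(ln(S + N₀))²] ≤ (ln(E[S] + e + N₀))² + (ln N₀)²`. -/
theorem stmt12 (Ω : Type) [MeasurableSpace Ω] (μ : Measure Ω)
    [IsProbabilityMeasure μ] (N₀ : ℝ) (hN₀ : 0 < N₀)
    (S : Ω → ℝ) (hSmeas : Measurable S) (hSnonneg : ∀ ω, 0 ≤ S ω)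
    (hSint : Integrable S μ)
    (hlogint : Integrable (fun ω => (Real.log (S ω + N₀)) ^ 2) μ) :
    ∫ ω, (Real.log (S ω + N₀)) ^ 2 ∂μ ≤
      (Real.log ((∫ ω, S ω ∂μ) + Real.exp 1 + N₀)) ^ 2 + (Real.log N₀) ^ 2 := by
  have hmem : ∀ ω, S ω + Real.exp 1 + N₀ ∈ Set.Ici (Real.exp 1) := fun ω => by
    rw [Set.mem_Ici]; linarith [hSnonneg ω]
  have hint : Integrable (fun ω => S ω + Real.exp 1 + N₀) μ :=
    (hSint.add (integrable_const _)).add (integrable_const _)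
  have hlog : Integrable (fun ω => (Real.log (S ω + Real.exp 1 + N₀)) ^ 2) μ := by
    refine (hint.const_mul 2).mono'
      ((Real.measurable_log.comp ((hSmeas.add_const _).add_const _)).pow_const
        2).aestronglyMeasurable (.of_forall fun ω => ?_)
    rw [Real.norm_of_nonneg (sq_nonneg _)]
    exact log_sq_le_two_mul ((Real.one_le_exp zero_le_one).trans (hmem ω))
  have hmean : ∫ ω, (S ω + Real.exp 1 + N₀) ∂μ = (∫ ω, S ω ∂μ) + Real.exp 1 + N₀ := by
    simp_rw [add_assoc]
    rw [integral_add hSint (integrable_const _)]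
    simp
  have hjensen := concaveOn_log_sq.le_map_integral
    ((Real.continuousOn_log.mono fun x hx => ((Real.exp_pos 1).trans_le hx).ne').pow 2)
    isClosed_Ici (.of_forall hmem) hint hlog
  rw [hmean] at hjensen
  calc ∫ ω, (Real.log (S ω + N₀)) ^ 2 ∂μ
      ≤ ∫ ω, ((Real.log (S ω + Real.exp 1 + N₀)) ^ 2 + (Real.log N₀) ^ 2) ∂μ :=
        integral_mono hlogint (hlog.add (integrable_const _))
          fun ω => log_add_sq_le (hSnonneg ω) hN₀
    _ = (∫ ω, (Real.log (S ω + Real.exp 1 + N₀)) ^ 2 ∂μ) + (Real.log N₀) ^ 2 := by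
        rw [integral_add hlog (integrable_const _)]
        simp
    _ ≤ _ := by gcongr
end

section
/- Let z_min ≤ z_max be real numbers, let z, z* ∈ [z_min, z_max], and let y ∈ ℝ. Define Γ_z(y) = y·1{y > 0} if z = z_min, Γ_z(y) = y·1{y < 0} if z = z_max (and z ≠ z_min), and Γ_z(y) = y otherwise. Then (z − z*)·Γ_z(y) ≤ (z − z*)·y. -/
/-- Projected-dynamics inequality for a box-constrained primal variable:
with `Γ_z(y) = y·1{y > 0}` if `z = z_min`, `Γ_z(y) = y·1{y < 0}` if `z = z_max`
(and `z ≠ z_min`), and `Γ_z(y) = y` otherwise, one has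
`(z − z*)·Γ_z(y) ≤ (z − z*)·y` for all `z, z* ∈ [z_min, z_max]`. -/
theorem stmt13 (zmin zmax : ℝ) (hbox : zmin ≤ zmax) (z zstar : ℝ)
    (hz : z ∈ Set.Icc zmin zmax) (hzstar : zstar ∈ Set.Icc zmin zmax) (y : ℝ) :
    (z - zstar) *
        (if z = zmin then (if 0 < y then y else 0)
          else if z = zmax then (if y < 0 then y else 0) else y)
      ≤ (z - zstar) * y := by
  obtain ⟨hlo, hhi⟩ := hzstar
  split_ifs with hmin hy hmax hy
  · exact le_rfl
  · rw [mul_zero]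
    exact mul_nonneg_of_nonpos_of_nonpos (by linarith) (not_lt.mp hy)
  · exact le_rfl
  · rw [mul_zero]
    exact mul_nonneg (by linarith) (not_lt.mp hy)
  · exact le_rfl
end
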